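/- arXiv:1905.11911 — 3 statements merged into one kernel-verified Lean document; each statement's English description precedes it below -/
import Mathlib

section
/- Let F : ℝ^d × ℝ^m → ℝ^l be Fréchet differentiable at (p, θ₀), and let A be the l×d matrix representing the partial derivative D_xF(p, θ₀); assume A·Aᵀ is invertible. Define the sample network g : ℝ^m → ℝ^d by g(θ) = p − Aᵀ(A·Aᵀ)⁻¹·(F(p, θ) − F(p, θ₀)). Then g(θ₀) = p, the map θ ↦ F(g(θ), θ) is differentiable at θ₀, and its Fréchet derivative at θ₀ is the zero linear map from ℝ^m to ℝ^l. -/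
open Matrix

/-- If `R` is a right inverse of the partial derivative of `F` in its first variable, correcting
the base point by `R (F (p, θ) - F (p, θ₀))` cancels the first-order variation of `F` in `θ`. -/
theorem HasFDerivAt.comp_sub_rightInverse_eq_zero {𝕜 E G H : Type*} [NontriviallyNormedField 𝕜]
    [NormedAddCommGroup E] [NormedSpace 𝕜 E] [NormedAddCommGroup G] [NormedSpace 𝕜 G]
    [NormedAddCommGroup H] [NormedSpace 𝕜 H] {F : E × G → H} {F' : E × G →L[𝕜] H} {p : E} {θ₀ : G}
    (hF : HasFDerivAt F F' (p, θ₀)) (R : H →L[𝕜] E) (hR : ∀ w, F' (R w, 0) = w) :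
    HasFDerivAt (fun θ => F (p - R (F (p, θ) - F (p, θ₀)), θ)) (0 : G →L[𝕜] H) θ₀ := by
  have h_slice : HasFDerivAt (fun θ => F (p, θ)) (F'.comp (ContinuousLinearMap.inr 𝕜 E G)) θ₀ :=
    hF.comp θ₀ (hasFDerivAt_prodMk_right p θ₀)
  have h_curve := ((R.hasFDerivAt.comp θ₀ (h_slice.sub_const (F (p, θ₀)))).const_sub p).prodMk
    (hasFDerivAt_id θ₀)
  have hF_curve : HasFDerivAt F F' (p - R (F (p, θ₀) - F (p, θ₀)), θ₀) := by simpa using hF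
  refine (HasFDerivAt.comp (f := fun θ => (p - R (F (p, θ) - F (p, θ₀)), θ)) θ₀
    hF_curve h_curve).congr_fderiv ?_
  ext v
  have h_split : ∀ w : E, F' (-w, v) = F' (0, v) - F' (w, 0) := fun w => by
    rw [← map_sub]; simp
  simp [h_split, hR]

/-- A matrix `A` with `A * Aᵀ` invertible has right inverse `Aᵀ * (A * Aᵀ)⁻¹`. -/
theorem Matrix.toEuclideanLin_transpose_mul_inv_apply {m n : Type*} [Fintype m] [DecidableEq m]
    [Fintype n] [DecidableEq n] {A : Matrix m n ℝ} (hA : IsUnit (A * Aᵀ))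
    (w : EuclideanSpace ℝ m) :
    Matrix.toEuclideanLin A (Matrix.toEuclideanLin (Aᵀ * (A * Aᵀ)⁻¹) w) = w := by
  have h_mul : A * (Aᵀ * (A * Aᵀ)⁻¹) = 1 := by
    rw [← Matrix.mul_assoc, Matrix.mul_nonsing_inv _ ((Matrix.isUnit_iff_isUnit_det _).1 hA)]
  simp [Matrix.toLpLin_apply, Matrix.mulVec_mulVec, h_mul]

/-- Equation (8): the sample network `g(θ) = p − A†(F(p,θ) − F(p,θ₀))`, with
`A† = Aᵀ(A·Aᵀ)⁻¹` the pseudoinverse of `A = D_xF(p,θ₀)`, satisfies the first-order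
level-set-preservation conditions of Equation (6): `g(θ₀) = p` and
`(∂/∂θ)|_{θ₀} F(g(θ), θ) = 0`. -/
theorem sample_network_preserves_level_set_to_first_order
    (d m l : ℕ)
    (F : EuclideanSpace ℝ (Fin d) × EuclideanSpace ℝ (Fin m) → EuclideanSpace ℝ (Fin l))
    (p : EuclideanSpace ℝ (Fin d)) (θ₀ : EuclideanSpace ℝ (Fin m))
    (hF : DifferentiableAt ℝ F (p, θ₀))
    (A : Matrix (Fin l) (Fin d) ℝ)
    (hA : ∀ v : EuclideanSpace ℝ (Fin d),
      Matrix.toEuclideanLin A v = fderiv ℝ F (p, θ₀) (v, 0))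
    (hAAT : IsUnit (A * Aᵀ))
    (g : EuclideanSpace ℝ (Fin m) → EuclideanSpace ℝ (Fin d))
    (hg : ∀ θ, g θ = p - Matrix.toEuclideanLin (Aᵀ * (A * Aᵀ)⁻¹) (F (p, θ) - F (p, θ₀))) :
    g θ₀ = p ∧
    DifferentiableAt ℝ (fun θ => F (g θ, θ)) θ₀ ∧
    fderiv ℝ (fun θ => F (g θ, θ)) θ₀ = 0 := by
  have h_deriv := hF.hasFDerivAt.comp_sub_rightInverse_eq_zero
    (Matrix.toEuclideanLin (Aᵀ * (A * Aᵀ)⁻¹)).toContinuousLinearMap fun w => by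
      rw [← hA]
      exact Matrix.toEuclideanLin_transpose_mul_inv_apply hAAT w
  have h_eq : (fun θ => F (g θ, θ)) = fun θ => F (p - (Matrix.toEuclideanLin
      (Aᵀ * (A * Aᵀ)⁻¹)).toContinuousLinearMap (F (p, θ) - F (p, θ₀)), θ) := by
    funext θ
    rw [hg]
    rfl
  rw [h_eq]
  exact ⟨by simp [hg], h_deriv.differentiableAt, h_deriv.fderiv⟩
end

section
/- Let P ⊆ ℝ^d be closed, let a_1, …, a_k ∈ ℝ^d be nonzero, b_1, …, b_k ∈ ℝ, h_i(x) = ⟪a_i, x⟫ + b_i, and assume frontier(P) ⊆ ⋃_{i=1}^k {x | h_i(x) = 0}. Let x₀ ∈ interior(P) satisfy h_i(x₀) ≠ 0 for all i, and define λ ∈ {−1,1}^k by λ_i = sign(h_i(x₀)). Then x₀ lies in the interior of P_λ = ⋂_{i=1}^k {x | λ_i·h_i(x) ≥ 0}, and P_λ ⊆ P. -/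
open RealInnerProductSpace

/-- A preconnected set that meets the interior of `P` and avoids its frontier is contained in
the interior of `P`. -/
theorem IsPreconnected.subset_interior_of_disjoint_frontier {X : Type*} [TopologicalSpace X]
    {U P : Set X} (hU : IsPreconnected U) (hUP : (U ∩ interior P).Nonempty)
    (hdisj : Disjoint U (frontier P)) : U ⊆ interior P := by
  refine hU.subset_left_of_subset_union isOpen_interior isClosed_closure.isOpen_compl
    (disjoint_compl_right.mono_left interior_subset_closure) (fun x hx => ?_) hUP
  by_contra hx'
  rw [Set.mem_union, Set.mem_compl_iff, not_or, not_not] at hx'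
  exact Set.disjoint_left.mp hdisj hx ⟨hx'.2, hx'.1⟩

/-- Let the frontier of the closed set `P` be covered by finitely many hyperplanes. The closed cell
of the arrangement around an interior point `x₀` of `P` off all the hyperplanes is a neighbourhood
of `x₀` contained in `P`. -/
theorem mem_interior_closedCell_and_closedCell_subset {E ι : Type*} [NormedAddCommGroup E]
    [InnerProductSpace ℝ E] [Finite ι] {P : Set E} (hP : IsClosed P) (a : ι → E) (b : ι → ℝ)
    (hfr : frontier P ⊆ ⋃ i, {x : E | ⟪a i, x⟫ + b i = 0})
    {x₀ : E} (hx₀ : x₀ ∈ interior P) {lam : ι → ℝ}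
    (hpos : ∀ i, 0 < lam i * (⟪a i, x₀⟫ + b i)) :
    x₀ ∈ interior (⋂ i, {x : E | 0 ≤ lam i * (⟪a i, x⟫ + b i)}) ∧
    (⋂ i, {x : E | 0 ≤ lam i * (⟪a i, x⟫ + b i)}) ⊆ P := by
  let U : Set E := ⋂ i, {x | 0 < lam i * (⟪a i, x⟫ + b i)}
  have hU_open : IsOpen U :=
    isOpen_iInter_of_finite fun i => isOpen_lt continuous_const (by fun_prop)
  have mem_U {x : E} : x ∈ U ↔ ∀ i, 0 < lam i * (⟪a i, x⟫ + b i) := by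
    simp only [U, Set.mem_iInter, Set.mem_ofPred_eq]
  have hx₀U : x₀ ∈ U := mem_U.mpr hpos
  have hcombo (i : ι) (x y : E) {s t : ℝ} (hst : s + t = 1) :
      lam i * (⟪a i, s • x + t • y⟫ + b i) =
        s * (lam i * (⟪a i, x⟫ + b i)) + t * (lam i * (⟪a i, y⟫ + b i)) := by
    simp only [inner_add_right, real_inner_smul_right]
    linear_combination -(lam i * b i) * hst
  have hsegment {x y : E} (hx : x ∈ U)
      (hy : ∀ i, 0 ≤ lam i * (⟪a i, y⟫ + b i)) : openSegment ℝ x y ⊆ U := by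
    rintro _ ⟨s, t, hs, ht, hst, rfl⟩
    refine mem_U.mpr fun i => ?_
    rw [hcombo i x y hst]
    exact add_pos_of_pos_of_nonneg (mul_pos hs (mem_U.mp hx i)) (mul_nonneg ht.le (hy i))
  have hU_convex : Convex ℝ U := convex_iff_openSegment_subset.mpr fun x hx y hy =>
    hsegment hx fun i => (mem_U.mp hy i).le
  have hU_frontier : Disjoint U (frontier P) := Set.disjoint_left.mpr fun x hx hxP => by
    obtain ⟨i, hi⟩ := Set.mem_iUnion.mp (hfr hxP)
    have hxi := mem_U.mp hx i
    rw [Set.mem_ofPred_eq.mp hi, mul_zero] at hxi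
    exact hxi.false
  have hUP : U ⊆ P :=
    (hU_convex.isPreconnected.subset_interior_of_disjoint_frontier ⟨x₀, hx₀U, hx₀⟩
      hU_frontier).trans interior_subset
  have hU_cell : U ⊆ ⋂ i, {x : E | 0 ≤ lam i * (⟪a i, x⟫ + b i)} := fun x hx => by
    simpa only [Set.mem_iInter, Set.mem_ofPred_eq] using fun i => (mem_U.mp hx i).le
  refine ⟨interior_maximal hU_cell hU_open hx₀U, fun x hx => ?_⟩
  simp only [Set.mem_iInter, Set.mem_ofPred_eq] at hx
  have hx_closure : x ∈ closure (openSegment ℝ x₀ x) :=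
    segment_subset_closure_openSegment (right_mem_segment ℝ x₀ x)
  exact closure_minimal ((hsegment hx₀U hx).trans hUP) hP hx_closure

/-- Case 1 in the proof of Theorem 1: if `P` is closed with boundary contained in the
hyperplane arrangement `⋃_i {h_i = 0}`, and `x₀` is an interior point of `P` lying on no
hyperplane, then with `λ_i = sign(h_i(x₀))` the minimal polytope
`P_λ = ⋂_i {x | λ_i·h_i(x) ≥ 0}` contains `x₀` in its interior and is contained in `P`. -/
theorem minimal_polytope_of_interior_point
    (d k : ℕ) (P : Set (EuclideanSpace ℝ (Fin d))) (hP : IsClosed P)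
    (a : Fin k → EuclideanSpace ℝ (Fin d)) (ha : ∀ i, a i ≠ 0) (b : Fin k → ℝ)
    (hfr : frontier P ⊆ ⋃ i, {x : EuclideanSpace ℝ (Fin d) | ⟪a i, x⟫ + b i = 0})
    (x₀ : EuclideanSpace ℝ (Fin d)) (hx₀ : x₀ ∈ interior P)
    (hx₀' : ∀ i, ⟪a i, x₀⟫ + b i ≠ 0)
    (lam : Fin k → ℝ) (hlam : ∀ i, lam i = Real.sign (⟪a i, x₀⟫ + b i)) :
    x₀ ∈ interior (⋂ i, {x : EuclideanSpace ℝ (Fin d) | 0 ≤ lam i * (⟪a i, x⟫ + b i)}) ∧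
    (⋂ i, {x : EuclideanSpace ℝ (Fin d) | 0 ≤ lam i * (⟪a i, x⟫ + b i)}) ⊆ P := by
  exact mem_interior_closedCell_and_closedCell_subset hP a b hfr hx₀ fun i =>
    hlam i ▸ Real.sign_mul_pos_of_ne_zero _ (hx₀' i)
end

section
/- Let h_i(x) = ⟪a_i, x⟫ + b_i for i ∈ [k] be affine functions on ℝ^d with all a_i ≠ 0, let P ⊆ ℝ^d be closed with frontier(P) ⊆ ⋃_{i=1}^k {x | h_i(x) = 0}, let Λ ⊆ {−1,0,1}^k be a finite nonempty set such that P_λ ⊆ P for every λ ∈ Λ, and assume frontier(P) ⊆ ⋃_{λ∈Λ} P_λ. Define f(x) = max_{λ∈Λ} min_{i∈[k]} λ_i·h_i(x). Then frontier(P) ⊆ {x | f(x) = 0} ⊆ P, and f(x) < 0 for every x ∉ P. -/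
open RealInnerProductSpace

/-- The level-set representation at the heart of Theorem 1: for a closed set `P` whose
boundary lies in the hyperplane arrangement `⋃_i {h_i = 0}` and is covered by polytopes
`P_λ ⊆ P`, `λ ∈ Λ ⊆ {−1,0,1}^k`, the piecewise linear function
`f(x) = max_{λ∈Λ} min_{i∈[k]} λ_i·h_i(x)` satisfies
`frontier P ⊆ {f = 0} ⊆ P` and `f < 0` outside `P`. -/
theorem boundary_is_level_set_of_max_min
    (d k : ℕ) (hk : 0 < k)
    (a : Fin k → EuclideanSpace ℝ (Fin d)) (ha : ∀ i, a i ≠ 0) (b : Fin k → ℝ)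
    (P : Set (EuclideanSpace ℝ (Fin d))) (hP : IsClosed P)
    (hfr : frontier P ⊆ ⋃ i, {x : EuclideanSpace ℝ (Fin d) | ⟪a i, x⟫ + b i = 0})
    (Λ : Finset (Fin k → ℝ)) (hΛne : Λ.Nonempty)
    (hsign : ∀ lam ∈ Λ, ∀ i, lam i = -1 ∨ lam i = 0 ∨ lam i = 1)
    (hsub : ∀ lam ∈ Λ,
      (⋂ i, {x : EuclideanSpace ℝ (Fin d) | 0 ≤ lam i * (⟪a i, x⟫ + b i)}) ⊆ P)
    (hcov : frontier P ⊆
      ⋃ lam ∈ Λ, ⋂ i, {x : EuclideanSpace ℝ (Fin d) | 0 ≤ lam i * (⟪a i, x⟫ + b i)})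
    (f : EuclideanSpace ℝ (Fin d) → ℝ)
    (hf : ∀ x, f x = Λ.sup' hΛne fun lam =>
      Finset.univ.inf' (Finset.univ_nonempty_iff.mpr ⟨⟨0, hk⟩⟩)
        fun i => lam i * (⟪a i, x⟫ + b i)) :
    frontier P ⊆ {x | f x = 0} ∧ {x | f x = 0} ⊆ P ∧ ∀ x, x ∉ P → f x < 0 := by
  have nonneg_iff : ∀ x, 0 ≤ f x ↔ ∃ lam ∈ Λ, ∀ i, 0 ≤ lam i * (⟪a i, x⟫ + b i) := by
    intro x
    simp [hf, Finset.le_sup'_iff, Finset.le_inf'_iff]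
  have mem_of_nonneg : ∀ x, 0 ≤ f x → x ∈ P := by
    intro x hx
    obtain ⟨lam, hlam, h⟩ := (nonneg_iff x).mp hx
    exact hsub lam hlam (Set.mem_iInter.mpr h)
  refine ⟨fun x hx => le_antisymm ?_ ?_, fun x hx => mem_of_nonneg x (le_of_eq hx.symm),
    fun x hx => lt_of_not_ge fun h => hx (mem_of_nonneg x h)⟩
  · obtain ⟨i, hi⟩ := Set.mem_iUnion.mp (hfr hx)
    rw [hf]
    refine Finset.sup'_le _ _ fun lam _ => (Finset.inf'_le _ (Finset.mem_univ i)).trans ?_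
    rw [Set.mem_ofPred_eq.mp hi, mul_zero]
  · obtain ⟨lam, hlam, h⟩ := Set.mem_iUnion₂.mp (hcov hx)
    exact (nonneg_iff x).mpr ⟨lam, hlam, Set.mem_iInter.mp h⟩
end
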